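/- arXiv:1407.3385 — 3 statements merged into one kernel-verified Lean document; each statement's English description precedes it below -/
import Mathlib

section
/- For every λ > 0 and μ^1, …, μ^L ≥ 0, one has Λ^{-1} · M(λ,μ) · Λ = C(λ,μ), where Λ is the lower-triangular all-ones matrix. -/
open Finset

/-- The matrix `M(λ,μ)`: every row is `(μ^1/λ, …, μ^L/λ)` with an extra `1` added on the
subdiagonal (`(j,k)` entry is `μ^k/λ + 1` if `k = j - 1` and `μ^k/λ` otherwise). -/
noncomputable def Mmat (L : ℕ) (lam : ℝ) (mu : Fin L → ℝ) : Matrix (Fin L) (Fin L) ℝ :=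
  Matrix.of fun j k => mu k / lam + if (k : ℕ) + 1 = (j : ℕ) then 1 else 0

/-- `a(k) = (μ^k + μ^{k+1} + ⋯ + μ^L)/λ` (with `0`-based index `k`). -/
noncomputable def aCoef (L : ℕ) (lam : ℝ) (mu : Fin L → ℝ) (k : Fin L) : ℝ :=
  (∑ l ∈ Finset.univ.filter fun l : Fin L => (k : ℕ) ≤ (l : ℕ), mu l) / lam

/-- The matrix `C(λ,μ)`: first row `(a(1), …, a(L))`, and `j`-th row (`2 ≤ j ≤ L`)
the standard basis row vector `e_{j-1}`. -/
noncomputable def Cmat (L : ℕ) (lam : ℝ) (mu : Fin L → ℝ) : Matrix (Fin L) (Fin L) ℝ :=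
  Matrix.of fun j k =>
    if (j : ℕ) = 0 then aCoef L lam mu k
    else if (k : ℕ) + 1 = (j : ℕ) then 1 else 0

/-- The `L × L` lower-triangular all-ones matrix `Λ`. -/
def lowerOnes (L : ℕ) : Matrix (Fin L) (Fin L) ℝ :=
  Matrix.of fun j k => if (k : ℕ) ≤ (j : ℕ) then 1 else 0

theorem aux_sum (L : ℕ) (f : Fin L → ℝ) (m : Fin L) (p : Fin L → Prop) [DecidablePred p]
    (hp : ∀ l, p l ↔ l = m) : (∑ l, if p l then f l else 0) = f m := by
  simp [hp]

theorem aux_det (L : ℕ) : (lowerOnes L).det = 1 := by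
  rw [Matrix.det_of_lowerTriangular]
  · simp [lowerOnes]
  · intro i j hij
    have h : i < j := hij
    simp [lowerOnes, h]

theorem aux_mul (L : ℕ) (hL : 1 ≤ L) (lam : ℝ) (mu : Fin L → ℝ) :
    Mmat L lam mu * lowerOnes L = lowerOnes L * Cmat L lam mu := by
  ext j k
  have h1 : (Mmat L lam mu * lowerOnes L) j k
      = aCoef L lam mu k + if (k : ℕ) + 1 ≤ j then 1 else 0 := by
    have e : ∀ l : Fin L, Mmat L lam mu j l * lowerOnes L l k
        = (if (k : ℕ) ≤ l then mu l / lam else 0)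
          + (if (l : ℕ) + 1 = j ∧ (k : ℕ) ≤ l then 1 else 0) := by
      intro l
      simp only [Mmat, lowerOnes, Matrix.of_apply]
      split_ifs <;> simp_all
    rw [Matrix.mul_apply, Finset.sum_congr rfl (fun l _ => e l), Finset.sum_add_distrib]
    congr 1
    · rw [aCoef, Finset.sum_div, Finset.sum_filter]
    · split_ifs with h
      · exact aux_sum L (fun _ => 1) ⟨j - 1, by omega⟩ _
          (fun l => by rw [Fin.ext_iff]; simp only; omega)
      · apply Finset.sum_eq_zero
        intro l _
        rw [if_neg]
        omega
  have h2 : (lowerOnes L * Cmat L lam mu) j k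
      = aCoef L lam mu k + if (k : ℕ) + 1 ≤ j then 1 else 0 := by
    have e : ∀ l : Fin L, lowerOnes L j l * Cmat L lam mu l k
        = (if (l : ℕ) = 0 then aCoef L lam mu k else 0)
          + (if (k : ℕ) + 1 = l ∧ (l : ℕ) ≤ j then 1 else 0) := by
      intro l
      simp only [Cmat, lowerOnes, Matrix.of_apply]
      split_ifs <;> first | omega | simp
    rw [Matrix.mul_apply, Finset.sum_congr rfl (fun l _ => e l), Finset.sum_add_distrib]
    congr 1
    · exact aux_sum L (fun _ => aCoef L lam mu k) ⟨0, hL⟩ _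
          (fun l => by rw [Fin.ext_iff])
    · split_ifs with h
      · exact aux_sum L (fun _ => 1) ⟨k + 1, by omega⟩ _
          (fun l => by rw [Fin.ext_iff]; simp only; omega)
      · apply Finset.sum_eq_zero
        intro l _
        rw [if_neg]
        omega
  rw [h1, h2]

/-- For every `λ > 0` and `μ^1, …, μ^L ≥ 0`, one has `Λ⁻¹ · M(λ,μ) · Λ = C(λ,μ)`. -/
theorem stmt_2 (L : ℕ) (hL : 1 ≤ L) (lam : ℝ) (mu : Fin L → ℝ)
    (hlam : 0 < lam) (hmu : ∀ l, 0 ≤ mu l) :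
    (lowerOnes L)⁻¹ * Mmat L lam mu * lowerOnes L = Cmat L lam mu := by
  rw [Matrix.mul_assoc, aux_mul L hL, ← Matrix.mul_assoc, Matrix.nonsing_inv_mul, Matrix.one_mul]
  rw [aux_det]
  exact isUnit_one
end

section
/- Let n ≥ L and let C_1, …, C_n be L×L real matrices such that, for each i, every entry of the first row of C_i is strictly positive and, for 2 ≤ j ≤ L, the j-th row of C_i is the standard basis row vector e_{j−1}. Then every entry of the product C_1 C_2 ⋯ C_n is strictly positive. -/
theorem aux_prod (L : ℕ) (hL : 0 < L) (l : List (Matrix (Fin L) (Fin L) ℝ))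
    (h1 : ∀ M ∈ l, ∀ k, 0 < M ⟨0, hL⟩ k)
    (h2 : ∀ M ∈ l, ∀ j k : Fin L, (j : ℕ) ≠ 0 →
      M j k = if (k : ℕ) + 1 = (j : ℕ) then 1 else 0) :
    (∀ j k, 0 ≤ l.prod j k) ∧ (∀ k, ∃ j, 0 < l.prod j k) ∧
      (∀ j k : Fin L, (j : ℕ) < l.length → 0 < l.prod j k) := by
  induction l with
  | nil =>
    refine ⟨fun j k => ?_, fun k => ⟨k, ?_⟩, fun j k h => ?_⟩
    · simp only [List.prod_nil, Matrix.one_apply]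
      split_ifs <;> norm_num
    · simp
    · simp at h
  | cons M l ih =>
    obtain ⟨a, b, c⟩ := ih (fun N hN => h1 N (List.mem_cons_of_mem _ hN))
      (fun N hN => h2 N (List.mem_cons_of_mem _ hN))
    have h1 := h1 M List.mem_cons_self
    have h2 := h2 M List.mem_cons_self
    have r0 : ∀ k, 0 < (M :: l).prod ⟨0, hL⟩ k := by
      intro k
      rw [List.prod_cons, Matrix.mul_apply]
      obtain ⟨j, hj⟩ := b k
      exact Finset.sum_pos' (fun i _ => mul_nonneg (h1 i).le (a i k))
        ⟨j, Finset.mem_univ _, mul_pos (h1 j) hj⟩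
    have rs : ∀ j k : Fin L, (j : ℕ) ≠ 0 →
        (M :: l).prod j k = l.prod ⟨(j : ℕ) - 1, by omega⟩ k := by
      intro j k hj
      rw [List.prod_cons, Matrix.mul_apply,
        Finset.sum_eq_single (⟨(j : ℕ) - 1, by omega⟩ : Fin L)]
      · rw [h2 _ _ hj, if_pos (by simp only; omega), one_mul]
      · intro i _ hi
        rw [h2 _ _ hj, if_neg, zero_mul]
        intro h
        exact hi (Fin.ext (by simp only; omega))
      · simp
    refine ⟨fun j k => ?_, fun k => ⟨_, r0 k⟩, fun j k h => ?_⟩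
    · by_cases hj : (j : ℕ) = 0
      · have : j = ⟨0, hL⟩ := Fin.ext hj
        rw [this]; exact (r0 k).le
      · rw [rs j k hj]; exact a _ _
    · by_cases hj : (j : ℕ) = 0
      · have : j = ⟨0, hL⟩ := Fin.ext hj
        rw [this]; exact r0 k
      · rw [rs j k hj]
        refine c _ _ ?_
        simp only [List.length_cons] at h
        simp only
        omega


/-- Let `n ≥ L ≥ 1` and let `C_1, …, C_n` be `L × L` real matrices such that, for each `i`,
every entry of the first row of `C_i` is strictly positive and, for `2 ≤ j ≤ L`, the `j`-th
row of `C_i` is the standard basis row vector `e_{j-1}`. Then every entry of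
`C_1 C_2 ⋯ C_n` is strictly positive. -/
theorem stmt_6 (L : ℕ) (hL : 1 ≤ L) (n : ℕ) (hn : L ≤ n)
    (C : Fin n → Matrix (Fin L) (Fin L) ℝ)
    (hrow1 : ∀ i, ∀ k, 0 < C i ⟨0, by omega⟩ k)
    (hrows : ∀ i, ∀ j k : Fin L, (j : ℕ) ≠ 0 →
      C i j k = if (k : ℕ) + 1 = (j : ℕ) then 1 else 0) :
    ∀ j k : Fin L, 0 < ((List.finRange n).map C).prod j k := by
  intro j k
  refine (aux_prod L hL _ ?_ ?_).2.2 j k ?_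
  · intro M hM
    obtain ⟨i, _, rfl⟩ := List.mem_map.1 hM
    exact hrow1 i
  · intro M hM
    obtain ⟨i, _, rfl⟩ := List.mem_map.1 hM
    exact hrows i
  · simp only [List.length_map, List.length_finRange]
    omega
end

section
/- Let (λ_n)_{n≥0} be positive reals and (μ_n^l)_{n≥0, 1≤l≤L} nonnegative reals. Set q_n = λ_n + μ_n^1 + ⋯ + μ_n^L, M_n = M(λ_n,μ_n), P_0 = I and P_n = M_0 M_1 ⋯ M_{n-1} for n ≥ 1. Then the following identity holds in the extended nonnegative reals [0,∞]: 1/q_0 + Σ_{n≥1} (P_n)_{11}/q_n + Σ_{n≥1} ( Σ_{k=1}^L (P_n)_{1k} )/q_{n-1} = Σ_{n≥0} ( Σ_{k=1}^L (P_n)_{1k} )/λ_n. (This is the computation giving the quenched mean E_ω T_1 of the first passage time of the birth and death process in random environment: with λ_n = λ_{-n}, μ_n^l = μ_{-n}^l, both sides equal Σ_{i≤0} (1/λ_i)·e_1 M_0 M_{-1} ⋯ M_{i+1} 𝟏.) -/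
open Finset

theorem Mmat_nonneg (L : ℕ) (lam : ℕ → ℝ) (mu : ℕ → Fin L → ℝ)
    (hlam : ∀ n, 0 < lam n) (hmu : ∀ n l, 0 ≤ mu n l) (n : ℕ) (i j : Fin L) :
    0 ≤ ((List.range n).map fun i => Mmat L (lam i) (mu i)).prod i j := by
  induction n generalizing i j with
  | zero =>
    simp only [List.range_zero, List.map_nil, List.prod_nil, Matrix.one_apply]
    split_ifs <;> norm_num
  | succ n ih =>
    rw [List.range_succ, List.map_append, List.prod_append, List.map_singleton,
      List.prod_singleton, Matrix.mul_apply]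
    refine Finset.sum_nonneg fun k _ => mul_nonneg (ih i k) ?_
    have h1 : 0 ≤ mu n j / lam n := div_nonneg (hmu n j) (hlam n).le
    simp only [Mmat, Matrix.of_apply]
    split_ifs <;> linarith

theorem Mmat_rowsum (L : ℕ) (a : ℝ) (m : Fin (L + 1) → ℝ) (j : Fin (L + 1)) :
    ∑ k, Mmat (L + 1) a m j k = (∑ k, m k) / a + (1 - if j = 0 then 1 else 0) := by
  simp only [Mmat, Matrix.of_apply]
  rw [Finset.sum_add_distrib, Finset.sum_div]
  congr 1
  refine Fin.cases ?_ (fun i => ?_) j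
  · simp
  · rw [Finset.sum_eq_single i.castSucc]
    · simp
    · intro b _ hb
      rw [if_neg]
      intro h
      apply hb
      ext
      simpa using h
    · simp

theorem row_rec (L : ℕ) (a : ℝ) (m : Fin (L + 1) → ℝ) (ha : 0 < a)
    (P : Matrix (Fin (L + 1)) (Fin (L + 1)) ℝ) :
    ∑ k, (P * Mmat (L + 1) a m) 0 k + P 0 0 = (∑ k, P 0 k) * (a + ∑ l, m l) / a := by
  simp only [Matrix.mul_apply]
  rw [Finset.sum_comm]
  simp only [← Finset.mul_sum, Mmat_rowsum, mul_add, mul_sub, Finset.sum_add_distrib,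
    Finset.sum_sub_distrib, ← Finset.sum_mul]
  simp
  field_simp
  ring

/-- With `q_n = λ_n + μ_n^1 + ⋯ + μ_n^L`, `P_0 = I`, `P_n = M_0 M_1 ⋯ M_{n-1}`, the identity
`1/q_0 + Σ_{n≥1} (P_n)_{11}/q_n + Σ_{n≥1} (Σ_{k=1}^L (P_n)_{1k})/q_{n-1}
  = Σ_{n≥0} (Σ_{k=1}^L (P_n)_{1k})/λ_n`
holds in `[0,∞]` (the computation of the quenched mean `E_ω T_1`). -/
theorem stmt_10 (L : ℕ) (hL : 1 ≤ L) (lam : ℕ → ℝ) (mu : ℕ → Fin L → ℝ)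
    (hlam : ∀ n, 0 < lam n) (hmu : ∀ n l, 0 ≤ mu n l) :
    (fun (q : ℕ → ℝ) (P : ℕ → Matrix (Fin L) (Fin L) ℝ) =>
        ENNReal.ofReal (1 / q 0)
          + (∑' n : ℕ, ENNReal.ofReal (P (n + 1) ⟨0, by omega⟩ ⟨0, by omega⟩ / q (n + 1)))
          + (∑' n : ℕ, ENNReal.ofReal ((∑ k, P (n + 1) ⟨0, by omega⟩ k) / q n))
        = ∑' n : ℕ, ENNReal.ofReal ((∑ k, P n ⟨0, by omega⟩ k) / lam n))
      (fun n => lam n + ∑ l, mu n l)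
      (fun n => ((List.range n).map fun i => Mmat L (lam i) (mu i)).prod) := by
  obtain ⟨L, rfl⟩ : ∃ L', L = L' + 1 := ⟨L - 1, by omega⟩
  have hq : ∀ n, 0 < lam n + ∑ l, mu n l := fun n =>
    add_pos_of_pos_of_nonneg (hlam n) (Finset.sum_nonneg fun l _ => hmu n l)
  have hP := Mmat_nonneg (L + 1) lam mu hlam hmu
  have hrec : ∀ n, ((List.range (n + 1)).map fun i => Mmat (L + 1) (lam i) (mu i)).prod =
      ((List.range n).map fun i => Mmat (L + 1) (lam i) (mu i)).prod
        * Mmat (L + 1) (lam n) (mu n) := fun n => by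
    rw [List.range_succ, List.map_append, List.prod_append, List.map_singleton,
      List.prod_singleton]
  have h0 : ((List.range 0).map fun i => Mmat (L + 1) (lam i) (mu i)).prod = 1 := by simp
  beta_reduce
  generalize hPd : (fun n => ((List.range n).map fun i => Mmat (L + 1) (lam i) (mu i)).prod) = P
  have e : ∀ n, ((List.range n).map fun i => Mmat (L + 1) (lam i) (mu i)).prod = P n :=
    fun n => congrFun hPd n
  simp only [e] at hP hrec h0 ⊢
  change _ + (∑' n : ℕ, ENNReal.ofReal (P (n + 1) 0 0 / _))
    + (∑' n : ℕ, ENNReal.ofReal ((∑ k, P (n + 1) 0 k) / _))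
      = ∑' n : ℕ, ENNReal.ofReal ((∑ k, P n 0 k) / lam n)
  have h1 : ENNReal.ofReal (1 / (lam 0 + ∑ l, mu 0 l))
      + (∑' n : ℕ, ENNReal.ofReal (P (n + 1) 0 0 / (lam (n + 1) + ∑ l, mu (n + 1) l)))
      = ∑' n : ℕ, ENNReal.ofReal (P n 0 0 / (lam n + ∑ l, mu n l)) := by
    rw [tsum_eq_zero_add' (f := fun n => ENNReal.ofReal (P n 0 0 / (lam n + ∑ l, mu n l)))
      ENNReal.summable, h0]
    simp
  rw [h1, ← ENNReal.tsum_add]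
  refine tsum_congr fun n => ?_
  rw [← ENNReal.ofReal_add (div_nonneg (hP _ _ _) (hq n).le)
    (div_nonneg (Finset.sum_nonneg fun k _ => hP _ _ _) (hq n).le), ← add_div, add_comm (P n 0 0),
    hrec, row_rec L _ _ (hlam n)]
  congr 1
  have := (hq n).ne'
  have := (hlam n).ne'
  field_simp
end
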